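/- Let A = ⊕_{i∈ℤ} A_i be a commutative ℤ-graded ring such that A_0 is noetherian and A is finitely generated as an A_0-algebra, and let I ⊆ A be a homogeneous ideal. Then there exists an integer d ≥ 1 such that for every n ≥ 0 one has the equality of ideals of A_0: I^{dn} ∩ A_0 = (I^d ∩ A_0)^n, where (I^d ∩ A_0)^n denotes the n-th power of the ideal I^d ∩ A_0 in the ring A_0. -/

import Mathlib

open Finset in
/-- In a finitely generated additive submonoid, every element of large weight has a summand
of a fixed weight. -/
theorem AddSubmonoid.FG.exists_split_weight {N : Type*} [AddCommMonoid N] {P : AddSubmonoid N}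
    (hP : P.FG) (w : N →+ ℕ) :
    ∃ k L : ℕ, 1 ≤ k ∧ 1 ≤ L ∧ ∀ a ∈ P, k * L ≤ w a →
      ∃ b ∈ P, ∃ c ∈ P, a = b + c ∧ w b = L := by
  classical
  obtain ⟨S, rfl⟩ := hP
  set L := ∏ s ∈ S with w s ≠ 0, w s with hL
  have hL1 : 1 ≤ L := Nat.one_le_iff_ne_zero.2 <| prod_ne_zero_iff.2 fun s hs ↦ (mem_filter.1 hs).2
  refine ⟨#S + 1, L, by lia, hL1, fun a ha hwa ↦ ?_⟩
  obtain ⟨c, -, rfl⟩ := AddSubmonoid.mem_closure_finset.1 ha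
  obtain ⟨s, hs, hLs⟩ : ∃ s ∈ S, L ≤ c s * w s := by
    by_contra! h
    have h' := sum_le_card_nsmul S (fun s ↦ c s * w s) L fun s hs ↦ (h s hs).le
    simp only [map_sum, map_nsmul, smul_eq_mul] at hwa h'
    lia
  have hws : w s ≠ 0 := by
    intro h0
    simp [h0] at hLs
    lia
  obtain ⟨q, hq⟩ : w s ∣ L := dvd_prod_of_mem _ (mem_filter.2 ⟨hs, hws⟩)
  have hqc : q ≤ c s := by
    rw [hq, mul_comm] at hLs
    exact Nat.le_of_mul_le_mul_right hLs (Nat.pos_of_ne_zero hws)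
  have hmem : ∀ t ∈ S, t ∈ closure (S : Set N) := fun t ht ↦ subset_closure ht
  refine ⟨q • s, nsmul_mem (hmem s hs) _, (c s - q) • s + ∑ t ∈ S.erase s, c t • t,
    add_mem (nsmul_mem (hmem s hs) _)
      (_root_.sum_mem fun t ht ↦ nsmul_mem (hmem t (mem_of_mem_erase ht)) _), ?_, ?_⟩
  · rw [← add_assoc, ← add_nsmul, Nat.add_sub_cancel' hqc, add_sum_erase S (fun t ↦ c t • t) hs]
  · rw [map_nsmul, smul_eq_mul, hq, mul_comm]

section WeightSpan

variable (R : Type*) {A ι : Type*} [CommRing R] [CommRing A] [Algebra R A] [Fintype ι]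

/-- The `R`-span of the monomials in the family `x` of weight at least `n`, where `x i` has
weight `v i`. -/
def weightSpan (x : ι → A) (v : ι → ℕ) (n : ℕ) : Submodule R A :=
  Submodule.span R {y | ∃ a : ι → ℕ, n ≤ ∑ i, a i * v i ∧ ∏ i, x i ^ a i = y}

theorem weightSpan_mul_le (x : ι → A) (v : ι → ℕ) (m n : ℕ) :
    weightSpan R x v m * weightSpan R x v n ≤ weightSpan R x v (m + n) := by
  rw [weightSpan, weightSpan, Submodule.span_mul_span]
  refine Submodule.span_le.2 ?_
  rintro _ ⟨_, ⟨a, ha, rfl⟩, _, ⟨b, hb, rfl⟩, rfl⟩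
  refine Submodule.subset_span ⟨a + b, ?_, ?_⟩
  · simp only [Pi.add_apply, add_mul, Finset.sum_add_distrib]
    lia
  · simp [pow_add, Finset.prod_mul_distrib]

theorem mem_weightSpan_self (x : ι → A) (v : ι → ℕ) (i : ι) : x i ∈ weightSpan R x v (v i) := by
  classical
  exact Submodule.subset_span ⟨Pi.single i 1, by simp [Pi.single_apply],
    by simp [Pi.single_apply, pow_ite]⟩

theorem weightSpan_antitone (x : ι → A) (v : ι → ℕ) : Antitone (weightSpan R x v) :=
  fun _ _ hmn ↦ Submodule.span_mono fun _ ⟨a, ha, h⟩ ↦ ⟨a, hmn.trans ha, h⟩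

theorem weightSpan_zero (x : ι → A) (v : ι → ℕ)
    (hx : Algebra.adjoin R (Set.range x) = ⊤) : weightSpan R x v 0 = ⊤ := by
  rw [← top_le_iff, ← Algebra.top_toSubmodule, ← hx, Algebra.adjoin_eq_span]
  refine Submodule.span_le.2 fun y hy ↦ ?_
  induction hy using Submonoid.closure_induction with
  | mem y hy =>
    obtain ⟨i, rfl⟩ := hy
    exact weightSpan_antitone R x v (Nat.zero_le _) (mem_weightSpan_self R x v i)
  | one => exact Submodule.subset_span ⟨0, by simp, by simp⟩
  | mul y z _ _ hy hz => exact weightSpan_mul_le R x v 0 0 (Submodule.mul_mem_mul hy hz)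

/-- If `A` is generated by the `x i` and `I` is generated by those `x i` of positive weight, then
`I ^ n` is spanned by monomials of weight at least `n`. -/
theorem mem_weightSpan_of_mem_pow (x : ι → A) (v : ι → ℕ)
    (hx : Algebra.adjoin R (Set.range x) = ⊤) (I : Ideal A)
    (hI : I ≤ Ideal.span {y | ∃ i, 1 ≤ v i ∧ x i = y}) (n : ℕ) {y : A} (hy : y ∈ I ^ n) :
    y ∈ weightSpan R x v n := by
  have hone : ∀ y ∈ I, y ∈ weightSpan R x v 1 := by
    intro y hy
    refine Submodule.span_induction ?_ (zero_mem _) (fun _ _ _ _ ↦ add_mem) ?_ (hI hy)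
    · rintro _ ⟨i, hi, rfl⟩
      exact weightSpan_antitone R x v hi (mem_weightSpan_self R x v i)
    · intro a z _ hz
      have ha : a ∈ weightSpan R x v 0 := weightSpan_zero R x v hx ▸ Submodule.mem_top
      simpa using weightSpan_mul_le R x v 0 1 (Submodule.mul_mem_mul ha hz)
  induction n generalizing y with
  | zero => exact weightSpan_zero R x v hx ▸ Submodule.mem_top
  | succ n ih =>
    rw [pow_succ] at hy
    refine Submodule.mul_induction_on hy (fun a ha b hb ↦ ?_) (fun _ _ ↦ add_mem)
    exact weightSpan_mul_le R x v n 1 (Submodule.mul_mem_mul (ih ha) (hone b hb))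

end WeightSpan

section Graded

variable {A : Type*} [CommRing A] (𝒜 : ℤ → Submodule ℤ A) [GradedRing 𝒜]

theorem Ideal.IsHomogeneous.exists_finset_span_eq {I : Ideal A} (hI : I.IsHomogeneous 𝒜)
    (hfg : I.FG) :
    ∃ s : Finset A, Ideal.span (s : Set A) = I ∧ ∀ a ∈ s, SetLike.IsHomogeneousElem 𝒜 a := by
  classical
  obtain ⟨F, hF⟩ := hfg
  refine ⟨F.biUnion fun f ↦ (DirectSum.decompose 𝒜 f).support.image
    fun i ↦ (DirectSum.decompose 𝒜 f i : A), le_antisymm (Ideal.span_le.2 ?_) ?_, ?_⟩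
  · intro a ha
    simp only [Finset.coe_biUnion, Set.mem_iUnion, Finset.coe_image] at ha
    obtain ⟨f, hf, i, -, rfl⟩ := ha
    exact hI i (hF ▸ Ideal.subset_span hf)
  · rw [← hF]
    refine Ideal.span_le.2 fun f hf ↦ ?_
    rw [← DirectSum.sum_support_decompose 𝒜 f]
    refine _root_.sum_mem fun i hi ↦ Ideal.subset_span ?_
    simp only [Finset.coe_biUnion, Set.mem_iUnion, Finset.coe_image]
    exact ⟨f, hf, i, hi, rfl⟩
  · intro a ha
    simp only [Finset.mem_biUnion, Finset.mem_image] at ha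
    obtain ⟨f, -, i, -, rfl⟩ := ha
    exact ⟨i, SetLike.coe_mem _⟩

/-- A degree-zero element of the span of the monomials of weight at least `n` lies in every ideal
of the degree-zero subring containing all degree-zero monomials of weight at least `n`. -/
theorem mem_of_coe_mem_weightSpan {ι : Type*} [Fintype ι] (x : ι → A) (e : ι → ℤ) (v : ι → ℕ)
    (hxe : ∀ i, x i ∈ 𝒜 (e i)) (n : ℕ) (J : Ideal (SetLike.GradeZero.subring 𝒜))
    (hJ : ∀ a : ι → ℕ, ∑ i, a i * e i = 0 → n ≤ ∑ i, a i * v i →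
      ∀ y : SetLike.GradeZero.subring 𝒜, (y : A) = ∏ i, x i ^ a i → y ∈ J)
    (y : SetLike.GradeZero.subring 𝒜)
    (hy : (y : A) ∈ weightSpan (SetLike.GradeZero.subring 𝒜) x v n) : y ∈ J := by
  have key : ∀ z ∈ weightSpan (SetLike.GradeZero.subring 𝒜) x v n,
      ∀ r : SetLike.GradeZero.subring 𝒜, (r : A) = DirectSum.decompose 𝒜 z 0 → r ∈ J := by
    intro z hz
    induction hz using Submodule.span_induction with
    | mem z hz =>
      intro r hr
      obtain ⟨a, ha, rfl⟩ := hz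
      have hdeg : ∏ i, x i ^ a i ∈ 𝒜 (∑ i, a i * e i) := by
        simpa using SetLike.prod_pow_mem_graded 𝒜 e x a (F := Finset.univ) fun i _ ↦ hxe i
      by_cases h0 : ∑ i, a i * e i = 0
      · exact hJ a h0 ha r (hr.trans (DirectSum.decompose_of_mem_same 𝒜 (h0 ▸ hdeg)))
      · obtain rfl : r = 0 := Subtype.ext (hr.trans (DirectSum.decompose_of_mem_ne 𝒜 hdeg h0))
        exact J.zero_mem
    | zero =>
      intro r hr
      obtain rfl : r = 0 := Subtype.ext (by simp [hr])
      exact J.zero_mem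
    | add z z' _ _ hz hz' =>
      intro r hr
      obtain rfl : r = ⟨DirectSum.decompose 𝒜 z 0, SetLike.coe_mem _⟩ +
          ⟨DirectSum.decompose 𝒜 z' 0, SetLike.coe_mem _⟩ := Subtype.ext (by simp [hr])
      exact J.add_mem (hz _ rfl) (hz' _ rfl)
    | smul s z _ hz =>
      intro r hr
      obtain rfl : r = s * ⟨DirectSum.decompose 𝒜 z 0, SetLike.coe_mem _⟩ :=
        Subtype.ext (hr.trans (DirectSum.coe_decompose_mul_of_left_mem_zero 𝒜 s.2))
      exact J.mul_mem_left s (hz _ rfl)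
  exact key y hy y (DirectSum.decompose_of_mem_same 𝒜 y.2).symm

end Graded


/-- **Powers of the degree-zero part of a homogeneous ideal stabilize.**
Let `A = ⊕_{i∈ℤ} Aᵢ` be a commutative `ℤ`-graded ring such that `A₀` is
noetherian and `A` is a finitely generated `A₀`-algebra (i.e. `A` is generated
as a ring by `A₀` together with finitely many elements), and let `I ⊆ A` be a
homogeneous ideal.  Then there is an integer `d ≥ 1` such that for every
`n ≥ 0` we have `I^{dn} ∩ A₀ = (I^d ∩ A₀)ⁿ` as ideals of `A₀`, where
`J ∩ A₀` is formalized as the preimage (`Ideal.comap`) of the ideal `J` of `A`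
along the inclusion of the degree-zero subring `A₀ ↪ A`. -/
theorem pushforward_rees_algebra_generated_in_degree_one
    {A : Type*} [CommRing A] (𝒜 : ℤ → Submodule ℤ A) [GradedRing 𝒜]
    (hnoeth : IsNoetherianRing ↥(𝒜 0))
    (hfg : ∃ T : Finset A, Subring.closure ((𝒜 0 : Set A) ∪ (T : Set A)) = ⊤)
    (I : Ideal A) (hI : I.IsHomogeneous 𝒜) :
    ∃ d : ℕ, 1 ≤ d ∧ ∀ n : ℕ,
      (I ^ (d * n)).comap (SetLike.GradeZero.subring 𝒜).subtype
        = ((I ^ d).comap (SetLike.GradeZero.subring 𝒜).subtype) ^ n := by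
  classical
  set R := SetLike.GradeZero.subring 𝒜
  have hR : IsNoetherianRing R := hnoeth
  obtain ⟨T, hT⟩ := hfg
  have hft : Algebra.FiniteType (𝒜 0) A := by
    refine ⟨T, ?_⟩
    rw [← top_le_iff]
    intro y _
    have hy : y ∈ Subring.closure ((𝒜 0 : Set A) ∪ (T : Set A)) := hT ▸ Subring.mem_top y
    refine Subring.closure_le (t := (Algebra.adjoin (𝒜 0) (T : Set A)).toSubring).2 ?_ hy
    rintro z (hz | hz)
    · exact (Algebra.adjoin (𝒜 0) (T : Set A)).algebraMap_mem ⟨z, hz⟩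
    · exact Algebra.subset_adjoin hz
  have hA : IsNoetherianRing A := Algebra.FiniteType.isNoetherianRing (𝒜 0) A
  obtain ⟨S, hS, hSh⟩ := GradedAlgebra.exists_finset_adjoin_eq_top_and_homogeneous 𝒜
  obtain ⟨F, hF, hFh⟩ := hI.exists_finset_span_eq 𝒜 (IsNoetherian.noetherian I)
  let x : S ⊕ F → A := Sum.elim (↑) (↑)
  let v : S ⊕ F → ℕ := Sum.elim (fun _ ↦ 0) (fun _ ↦ 1)
  have hxh : ∀ i, SetLike.IsHomogeneousElem 𝒜 (x i) := by
    rintro (i | i)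
    · exact hSh i i.2
    · exact hFh i i.2
  choose e hxe using hxh
  have hxv : ∀ i, x i ∈ I ^ v i := by
    rintro (i | i)
    · simp [v]
    · simpa [v, x, ← hF] using Ideal.subset_span i.2
  have hxadj : Algebra.adjoin R (Set.range x) = ⊤ := by
    rw [← top_le_iff]
    refine (show ⊤ ≤ Algebra.adjoin R (S : Set A) from hS.ge).trans (Algebra.adjoin_mono ?_)
    exact fun s hs ↦ ⟨.inl ⟨s, hs⟩, rfl⟩
  have hIspan : I ≤ Ideal.span {y | ∃ i, 1 ≤ v i ∧ x i = y} := by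
    rw [← hF]
    exact Ideal.span_mono fun f hf ↦ ⟨.inr ⟨f, hf⟩, le_rfl, rfl⟩
  let deg : (S ⊕ F → ℕ) →+ ℤ :=
    { toFun a := ∑ i, a i * e i
      map_zero' := by simp
      map_add' a b := by simp [add_mul, Finset.sum_add_distrib] }
  let w : (S ⊕ F → ℕ) →+ ℕ :=
    { toFun a := ∑ i, a i * v i
      map_zero' := by simp
      map_add' a b := by simp [add_mul, Finset.sum_add_distrib] }
  obtain ⟨k, L, hk, hL, hsplit⟩ := (AddSubmonoid.fg_eqLocusM deg 0).exists_split_weight w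
  let J (n : ℕ) : Ideal R := (I ^ n).comap R.subtype
  have hmon (a : S ⊕ F → ℕ) : ∏ i, x i ^ a i ∈ I ^ w a := by
    change _ ∈ I ^ ∑ i, a i * v i
    rw [← Finset.prod_pow_eq_pow_sum]
    refine Ideal.prod_mem_prod fun i _ ↦ ?_
    rw [mul_comm, pow_mul]
    exact Ideal.pow_mem_pow (hxv i) _
  have hmon0 (a : S ⊕ F → ℕ) (ha : deg a = 0) : ∏ i, x i ^ a i ∈ R := by
    have := SetLike.prod_pow_mem_graded 𝒜 e x a (F := Finset.univ) fun i _ ↦ hxe i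
    have h0 : ∑ i, a i • e i = 0 := by simpa [deg] using ha
    rw [h0] at this
    exact this
  have hstep (n : ℕ) (hn : k * L ≤ n + L) : J (n + L) ≤ J L * J n := by
    intro y hy
    refine mem_of_coe_mem_weightSpan 𝒜 x e v hxe (n + L) _ (fun a ha hwa z hz ↦ ?_) y
      (mem_weightSpan_of_mem_pow R x v hxadj I hIspan (n + L) hy)
    obtain ⟨b, hb, c, hc, rfl, hwb⟩ := hsplit a ha (hn.trans hwa)
    have hwc : n ≤ w c := by
      have : n + L ≤ w (b + c) := hwa
      rw [map_add] at this
      lia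
    have hzmul : z = ⟨_, hmon0 b hb⟩ * ⟨_, hmon0 c hc⟩ :=
      Subtype.ext <| by simp [hz, pow_add, Finset.prod_mul_distrib]
    rw [hzmul]
    exact Ideal.mul_mem_mul (hwb ▸ hmon b : _ ∈ I ^ L) (Ideal.pow_le_pow_right hwc (hmon c))
  have hiter (j : ℕ) : J (k * L + j * L) ≤ J L ^ j * J (k * L) := by
    induction j with
    | zero => simp
    | succ j ih =>
      rw [add_mul, one_mul, ← add_assoc, pow_succ', mul_assoc]
      exact (hstep _ (by lia)).trans (Ideal.mul_mono_right ih)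
  have hpow (m n : ℕ) : J m ^ n ≤ J (m * n) := by
    change _ ≤ (I ^ (m * n)).comap R.subtype
    rw [pow_mul]
    exact Ideal.le_comap_pow _ n
  refine ⟨k * L, Nat.mul_pos hk hL, fun n ↦ le_antisymm ?_ (hpow _ n)⟩
  change J (k * L * n) ≤ J (k * L) ^ n
  cases n with
  | zero => simp
  | succ n =>
    calc J (k * L * (n + 1)) = J (k * L + k * n * L) := by congr 1; ring
      _ ≤ J L ^ (k * n) * J (k * L) := hiter _
      _ ≤ J (k * L) ^ n * J (k * L) := by
        rw [pow_mul, mul_comm k L]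
        exact Ideal.mul_mono_left (Ideal.pow_right_mono (hpow L k) n)
      _ = J (k * L) ^ (n + 1) := (pow_succ _ _).symm
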